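/- arXiv:0911.0600 — 2 statements merged into one kernel-verified Lean document; each statement's English description precedes it below -/
import Mathlib

section
/- Let 0 = Z_0, Z_1, …, Z_n be random d×d Hermitian matrices forming a martingale with respect to a filtration F_0 ⊆ F_1 ⊆ … ⊆ F_n (i.e. each Z_i is F_i-measurable and E[Z_i | F_{i−1}] = Z_{i−1}). Suppose ‖Z_i − Z_{i−1}‖ ≤ M almost surely for each 1 ≤ i ≤ n, and define W_n := Σ_{i=1}^n E[(Z_i − Z_{i−1})² | F_{i−1}]. Then for all t, σ > 0: P(λ_max(Z_n) ≥ t and λ_max(W_n) ≤ σ²) ≤ d · exp(−t² / (8σ² + 4Mt)). -/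
open MeasureTheory ProbabilityTheory

/-- The spectral norm of a complex matrix: the operator norm of the associated
operator on Euclidean space. -/
noncomputable def specNorm {d : ℕ} (A : Matrix (Fin d) (Fin d) ℂ) : ℝ :=
  ‖Matrix.toEuclideanCLM (𝕜 := ℂ) A‖

/-- The largest eigenvalue of a (Hermitian) matrix, as the supremum of the Rayleigh
quotient over unit vectors. -/
noncomputable def lamMax {d : ℕ} (A : Matrix (Fin d) (Fin d) ℂ) : ℝ :=
  ⨆ v : {v : EuclideanSpace ℂ (Fin d) // ‖v‖ = 1},
    RCLike.re (inner (𝕜 := ℂ) (Matrix.toEuclideanCLM (𝕜 := ℂ) A v.1) v.1)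

section Auxiliary

open scoped Matrix.Norms.L2Operator MatrixOrder ComplexOrder Pointwise

section GoldenThompson

open Filter Topology NormedSpace

variable {m : Type*} [Fintype m] [DecidableEq m]

theorem Matrix.trace_mul_pow_comm (A B : Matrix m m ℂ) (N : ℕ) :
    ((A * B) ^ N).trace = ((B * A) ^ N).trace := by
  cases N with
  | zero => simp
  | succ N =>
    have h : B * (A * B) ^ N = (B * A) ^ N * B :=
      SemiconjBy.pow_right (show SemiconjBy B (A * B) (B * A) by
        simp [SemiconjBy, mul_assoc]) N
    rw [pow_succ', mul_assoc, h, Matrix.trace_mul_comm, pow_succ, mul_assoc]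

omit [DecidableEq m] in
theorem Matrix.re_trace_mul_le (A B : Matrix m m ℂ) :
    (A * B).trace.re ≤ ((A * star A).trace.re + (B * star B).trace.re) / 2 := by
  have h := (Matrix.posSemidef_self_mul_conjTranspose (star A - B)).trace_nonneg
  have h1 : (star A * star B).trace = star (B * A).trace := by
    rw [← Matrix.trace_conjTranspose, Matrix.conjTranspose_mul]; rfl
  have h2 : ((star A - B) * (star A - B).conjTranspose).trace
      = (A * star A).trace - star (A * B).trace - (A * B).trace + (B * star B).trace := by
    rw [← Matrix.star_eq_conjTranspose, star_sub, star_star, sub_mul, mul_sub, mul_sub,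
      Matrix.trace_sub, Matrix.trace_sub, Matrix.trace_sub, h1, Matrix.trace_mul_comm B A,
      Matrix.trace_mul_comm (star A) A]
    ring
  rw [h2] at h
  have h3 := (Complex.le_def.mp h).1
  simp at h3
  linarith

/-- A noncommutative Hölder inequality for products of `2 ^ (k + 1)` matrices. -/
theorem Matrix.re_trace_le_of_mem_pow (k : ℕ) (S : Set (Matrix m m ℂ)) (R : ℝ)
    (hS : ∀ A ∈ S, ((A * star A) ^ 2 ^ k).trace.re ≤ R)
    (M : Matrix m m ℂ) (hM : M ∈ S ^ 2 ^ (k + 1)) : M.trace.re ≤ R := by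
  induction k generalizing S M with
  | zero =>
    simp only [zero_add, pow_one, pow_two, pow_zero] at hM hS
    obtain ⟨A, hA, B, hB, rfl⟩ := Set.mem_mul.mp hM
    linarith [Matrix.re_trace_mul_le A B, hS A hA, hS B hB]
  | succ k ih =>
    rw [pow_succ' 2 (k + 1), pow_mul] at hM
    refine ih (S ^ 2) ?_ M hM
    intro C hC
    rw [pow_two] at hC
    obtain ⟨A, hA, B, hB, rfl⟩ := Set.mem_mul.mp hC
    have hcyc : ((A * B * star (A * B)) ^ 2 ^ k).trace
        = ((star A * A * (B * star B)) ^ 2 ^ k).trace := by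
      rw [star_mul, show A * B * (star B * star A) = (A * (B * star B)) * star A by
        simp [mul_assoc], Matrix.trace_mul_pow_comm, mul_assoc]
    rw [hcyc]
    refine ih {star A * A, B * star B} ?_ _ ?_
    · rintro P (rfl | rfl)
      · rw [star_mul, star_star, ← pow_two, ← pow_mul, ← pow_succ', Matrix.trace_mul_pow_comm]
        exact hS A hA
      · rw [star_mul, star_star, ← pow_two, ← pow_mul, ← pow_succ']
        exact hS B hB
    · rw [pow_succ', pow_mul]
      refine Set.pow_mem_pow ?_
      rw [pow_two]
      exact Set.mul_mem_mul (by simp) (by simp)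

theorem Matrix.re_trace_mul_pow_le (k : ℕ) {X Y : Matrix m m ℂ}
    (hX : IsSelfAdjoint X) (hY : IsSelfAdjoint Y) :
    ((X * Y) ^ 2 ^ k).trace.re ≤ (X ^ 2 ^ k * Y ^ 2 ^ k).trace.re := by
  induction k generalizing X Y with
  | zero => simp
  | succ k ih =>
    have h1 : ((X * Y) ^ 2 ^ (k + 1)).trace.re ≤ ((X * Y * star (X * Y)) ^ 2 ^ k).trace.re :=
      Matrix.re_trace_le_of_mem_pow k {X * Y} _ (by rintro A rfl; exact le_rfl) _
        (Set.pow_mem_pow (by simp))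
    have h2 : ((X * Y * star (X * Y)) ^ 2 ^ k).trace = ((X ^ 2 * Y ^ 2) ^ 2 ^ k).trace := by
      rw [star_mul, hX.star_eq, hY.star_eq, show X * Y * (Y * X) = (X * (Y * Y)) * X by
        simp [mul_assoc], Matrix.trace_mul_pow_comm, pow_two, pow_two, mul_assoc]
    rw [h2] at h1
    refine h1.trans ((ih (hX.pow 2) (hY.pow 2)).trans ?_)
    rw [← pow_mul, ← pow_mul, ← pow_succ']

theorem norm_pow_sub_pow_le_of_norm_le {R : Type*} [NormedRing R] (a b : R) (c : ℝ)
    (ha : ‖a‖ ≤ c) (hb : ‖b‖ ≤ c) (n : ℕ) :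
    ‖a ^ (n + 1) - b ^ (n + 1)‖ ≤ (n + 1) * c ^ n * ‖a - b‖ := by
  have hc : 0 ≤ c := (norm_nonneg a).trans ha
  induction n with
  | zero => simp
  | succ n ih =>
    have e : a ^ (n + 1 + 1) - b ^ (n + 1 + 1)
        = a * (a ^ (n + 1) - b ^ (n + 1)) + (a - b) * b ^ (n + 1) := by
      rw [pow_succ' a (n + 1), pow_succ' b (n + 1)]; noncomm_ring
    have hb' : ‖b ^ (n + 1)‖ ≤ c ^ (n + 1) :=
      (norm_pow_le' b n.succ_pos).trans (pow_le_pow_left₀ (norm_nonneg _) hb _)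
    calc _ ≤ ‖a‖ * ‖a ^ (n + 1) - b ^ (n + 1)‖ + ‖a - b‖ * ‖b ^ (n + 1)‖ := by
          rw [e]; exact (norm_add_le _ _).trans (add_le_add (norm_mul_le _ _) (norm_mul_le _ _))
      _ ≤ c * ((n + 1) * c ^ n * ‖a - b‖) + ‖a - b‖ * c ^ (n + 1) := by gcongr
      _ = _ := by push_cast; ring

theorem norm_exp_le_real_exp_norm {R : Type*} [NormedRing R] [NormOneClass R] [NormedAlgebra ℝ R]
    [CompleteSpace R] (x : R) : ‖exp x‖ ≤ Real.exp ‖x‖ := by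
  have h : HasSum (fun n : ℕ => ‖x‖ ^ n / n.factorial) (Real.exp ‖x‖) := by
    rw [Real.exp_eq_exp_ℝ]
    exact expSeries_div_hasSum_exp ‖x‖
  rw [exp_eq_tsum ℝ]
  refine tsum_of_norm_bounded h fun n => ?_
  rw [norm_smul, norm_inv, RCLike.norm_natCast, div_eq_inv_mul]
  gcongr
  exact norm_pow_le x n

/-- The Lie product formula. -/
theorem tendsto_exp_mul_exp_pow {R : Type*} [NormedRing R] [NormOneClass R] [NormedAlgebra ℝ R]
    [CompleteSpace R] (A B : R) :
    Tendsto (fun N : ℕ => (exp (((N : ℝ))⁻¹ • A) * exp (((N : ℝ))⁻¹ • B)) ^ N) atTop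
      (𝓝 (exp (A + B))) := by
  have hd : HasDerivAt (fun s : ℝ => exp (s • A) * exp (s • B) - exp (s • (A + B))) 0 0 := by
    have hA := hasDerivAt_exp_smul_const (𝕂 := ℝ) A (0 : ℝ)
    have hB := hasDerivAt_exp_smul_const (𝕂 := ℝ) B (0 : ℝ)
    have hC := hasDerivAt_exp_smul_const (𝕂 := ℝ) (A + B) (0 : ℝ)
    have h : HasDerivAt (fun s : ℝ => exp (s • A) * exp (s • B) - exp (s • (A + B))) _ 0 :=
      (hA.mul hB).sub hC
    convert h using 1
    simp
  have hlim : Tendsto (fun N : ℕ => (N : ℝ) • (exp (((N : ℝ))⁻¹ • A) * exp (((N : ℝ))⁻¹ • B)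
      - exp (((N : ℝ))⁻¹ • (A + B)))) atTop (𝓝 0) := by
    have h0 : Tendsto (fun N : ℕ => ((N : ℝ))⁻¹) atTop (𝓝[≠] 0) := by
      refine tendsto_nhdsWithin_iff.mpr ⟨tendsto_inv_atTop_nhds_zero_nat, ?_⟩
      filter_upwards [eventually_gt_atTop 0] with N hN
      simp; omega
    have := (hasDerivAt_iff_tendsto_slope_zero.mp hd).comp h0
    refine this.congr fun N => ?_
    simp
  have hnorm := (hlim.norm.mul_const (Real.exp (‖A‖ + ‖B‖)))
  rw [norm_zero, zero_mul] at hnorm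
  rw [tendsto_iff_norm_sub_tendsto_zero]
  refine squeeze_zero' (Eventually.of_forall fun _ => norm_nonneg _) ?_ hnorm
  filter_upwards [eventually_gt_atTop 0] with N hN
  obtain ⟨n, rfl⟩ : ∃ n, N = n + 1 := ⟨N - 1, by omega⟩
  have hNpos : (0 : ℝ) < ((n + 1 : ℕ) : ℝ) := by positivity
  set s : ℝ := (((n + 1 : ℕ) : ℝ))⁻¹ with hs
  have hs0 : 0 ≤ s := by positivity
  have hexp : exp (A + B) = exp (s • (A + B)) ^ (n + 1) := by
    let _ : NormedAlgebra ℚ R := NormedAlgebra.restrictScalars ℚ ℝ R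
    rw [← exp_nsmul, ← Nat.cast_smul_eq_nsmul ℝ, smul_smul, hs, mul_inv_cancel₀ hNpos.ne',
      one_smul]
  have hne (C : R) : ‖exp (s • C)‖ ≤ Real.exp (s * ‖C‖) := by
    simpa [norm_smul, abs_of_nonneg hs0] using norm_exp_le_real_exp_norm (s • C)
  have h1 : ‖exp (s • A) * exp (s • B)‖ ≤ Real.exp (s * (‖A‖ + ‖B‖)) := by
    rw [mul_add, Real.exp_add]
    exact (norm_mul_le _ _).trans (mul_le_mul (hne A) (hne B) (norm_nonneg _) (Real.exp_nonneg _))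
  have h2 : ‖exp (s • (A + B))‖ ≤ Real.exp (s * (‖A‖ + ‖B‖)) :=
    (hne _).trans (Real.exp_le_exp.mpr (mul_le_mul_of_nonneg_left (norm_add_le _ _) hs0))
  rw [hexp]
  refine (norm_pow_sub_pow_le_of_norm_le _ _ _ h1 h2 n).trans ?_
  rw [norm_smul, Real.norm_of_nonneg hNpos.le, ← Real.exp_nat_mul]
  have h3 : Real.exp (n * (s * (‖A‖ + ‖B‖))) ≤ Real.exp (‖A‖ + ‖B‖) := by
    rw [Real.exp_le_exp, ← mul_assoc]
    refine mul_le_of_le_one_left (by positivity) ?_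
    rw [hs, ← div_eq_mul_inv, div_le_one hNpos]
    push_cast; linarith
  calc _ = ((n + 1 : ℕ) : ℝ) * ‖exp (s • A) * exp (s • B) - exp (s • (A + B))‖
        * Real.exp (n * (s * (‖A‖ + ‖B‖))) := by push_cast; ring
    _ ≤ _ := by gcongr

/-- The **Golden–Thompson inequality**. -/
theorem Matrix.re_trace_exp_add_le {A B : Matrix m m ℂ}
    (hA : IsSelfAdjoint A) (hB : IsSelfAdjoint B) :
    (exp (A + B)).trace.re ≤ (exp A * exp B).trace.re := by
  cases isEmpty_or_nonempty m
  · simp [Matrix.trace]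
  have hlim := (tendsto_exp_mul_exp_pow A B).comp (tendsto_pow_atTop_atTop_of_one_lt one_lt_two)
  have hcont : Continuous fun M : Matrix m m ℂ => M.trace.re :=
    Complex.continuous_re.comp continuous_id.matrix_trace
  refine le_of_tendsto ((hcont.tendsto _).comp hlim) (Eventually.of_forall fun k => ?_)
  have hsa {C : Matrix m m ℂ} (hC : IsSelfAdjoint C) (s : ℝ) : IsSelfAdjoint (exp (s • C)) :=
    ((IsSelfAdjoint.all s).smul hC).exp
  have hpow (C : Matrix m m ℂ) : exp ((((2 ^ k : ℕ) : ℝ))⁻¹ • C) ^ 2 ^ k = exp C := by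
    let _ : NormedAlgebra ℚ (Matrix m m ℂ) := NormedAlgebra.restrictScalars ℚ ℝ _
    rw [← exp_nsmul, ← Nat.cast_smul_eq_nsmul ℝ, smul_smul, mul_inv_cancel₀ (by positivity),
      one_smul]
  have := Matrix.re_trace_mul_pow_le k (hsa hA (((2 ^ k : ℕ) : ℝ))⁻¹)
    (hsa hB (((2 ^ k : ℕ) : ℝ))⁻¹)
  rw [hpow, hpow] at this
  exact this

end GoldenThompson

section MatrixOrder

open NormedSpace

variable {m : Type*} [Fintype m] [DecidableEq m]

theorem Matrix.spectrum_real_abs_le_norm {A : Matrix m m ℂ} {x : ℝ} (hx : x ∈ spectrum ℝ A) :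
    |x| ≤ ‖A‖ := by
  cases isEmpty_or_nonempty m
  · exact absurd hx (by simp [spectrum.of_subsingleton])
  · simpa using spectrum.norm_le_norm_of_mem hx

theorem Matrix.exp_le_one_add_add_mul_self {B : Matrix m m ℂ} (hB : IsSelfAdjoint B)
    (hn : ‖B‖ ≤ 1) : exp B ≤ 1 + B + B * B := by
  have h : 1 + B + B * B = cfc (fun x : ℝ => 1 + x + x * x) B := by
    rw [cfc_add (a := B) (fun x : ℝ => 1 + x) (fun x : ℝ => x * x),
      cfc_add (a := B) (fun _ : ℝ => 1) (fun x : ℝ => x), cfc_mul (a := B) (fun x : ℝ => x)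
      (fun x : ℝ => x), cfc_id' ℝ B, cfc_const_one ℝ B]
  rw [h, ← CFC.real_exp_eq_normedSpace_exp hB]
  refine cfc_mono fun x hx => ?_
  have := (abs_le.mp (Real.abs_exp_sub_one_sub_id_le
    ((Matrix.spectrum_real_abs_le_norm hx).trans hn))).2
  nlinarith

theorem Matrix.mul_self_le_norm_smul {V : Matrix m m ℂ} (hV : 0 ≤ V) : V * V ≤ ‖V‖ • V := by
  have hsa : IsSelfAdjoint V := .of_nonneg hV
  have h1 : V * V = cfc (fun x : ℝ => x * x) V := by
    rw [cfc_mul (a := V) (fun x : ℝ => x) (fun x : ℝ => x), cfc_id' ℝ V]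
  have h2 : ‖V‖ • V = cfc (fun x : ℝ => ‖V‖ * x) V := by
    rw [cfc_const_mul (a := V) ‖V‖ (fun x : ℝ => x), cfc_id' ℝ V]
  rw [h1, h2]
  refine cfc_mono fun x hx => ?_
  exact mul_le_mul_of_nonneg_right ((le_abs_self x).trans (Matrix.spectrum_real_abs_le_norm hx))
    (spectrum_nonneg_of_nonneg hV hx)

theorem Matrix.smul_one_add_le_exp {H : Matrix m m ℂ} (hH : IsSelfAdjoint H) (c : ℝ) :
    Real.exp c • ((1 - c) • (1 : Matrix m m ℂ) + H) ≤ exp H := by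
  have h : Real.exp c • ((1 - c) • (1 : Matrix m m ℂ) + H)
      = cfc (fun x : ℝ => Real.exp c * ((1 - c) + x)) H := by
    rw [cfc_const_mul (a := H) _ (fun x : ℝ => (1 - c) + x),
      cfc_add (a := H) (fun _ : ℝ => 1 - c) (fun x : ℝ => x), cfc_id' ℝ H, cfc_const (1 - c) H,
      Algebra.algebraMap_eq_smul_one]
  rw [h, ← CFC.real_exp_eq_normedSpace_exp hH]
  refine cfc_mono fun x _ => ?_
  have h1 : Real.exp x = Real.exp c * Real.exp (x - c) := by rw [← Real.exp_add]; ring_nf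
  rw [h1]
  gcongr
  linarith [Real.add_one_le_exp (x - c)]

theorem Matrix.exp_nonneg_of_isSelfAdjoint {H : Matrix m m ℂ} (hH : IsSelfAdjoint H) :
    0 ≤ exp H := by
  rw [← CFC.real_exp_eq_normedSpace_exp hH]
  exact cfc_nonneg fun x _ => Real.exp_nonneg x

/-- The real part of the trace, as a continuous real-linear functional. -/
noncomputable def reTrace (m : Type*) [Fintype m] [DecidableEq m] : Matrix m m ℂ →L[ℝ] ℝ where
  toFun A := A.trace.re
  map_add' A B := by simp [Matrix.trace_add]
  map_smul' r A := by simp [Matrix.trace_smul]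
  cont := Complex.continuous_re.comp continuous_id.matrix_trace

theorem reTrace_apply (A : Matrix m m ℂ) : reTrace m A = A.trace.re := rfl

theorem reTrace_mul_comm (A B : Matrix m m ℂ) : reTrace m (A * B) = reTrace m (B * A) := by
  rw [reTrace_apply, Matrix.trace_mul_comm, reTrace_apply]

theorem reTrace_nonneg {A : Matrix m m ℂ} (hA : 0 ≤ A) : 0 ≤ reTrace m A :=
  (Complex.le_def.mp (Matrix.nonneg_iff_posSemidef.mp hA).trace_nonneg).1

theorem reTrace_mul_nonneg {A B : Matrix m m ℂ} (hA : 0 ≤ A) (hB : 0 ≤ B) :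
    0 ≤ reTrace m (A * B) := by
  obtain ⟨C, rfl⟩ := CStarAlgebra.nonneg_iff_eq_star_mul_self.mp hB
  rw [← mul_assoc, reTrace_mul_comm, ← mul_assoc]
  exact reTrace_nonneg (star_right_conjugate_nonneg hA C)

theorem reTrace_mul_le_mul_left {G A B : Matrix m m ℂ} (hG : 0 ≤ G) (hAB : A ≤ B) :
    reTrace m (G * A) ≤ reTrace m (G * B) := by
  have := reTrace_mul_nonneg hG (sub_nonneg.mpr hAB)
  rw [mul_sub, map_sub] at this
  linarith

/-- The Rayleigh quotient of `A` at `v` is the trace of `A` against the rank-one matrix `v v*`. -/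
theorem re_inner_eq_reTrace {d : ℕ} (A : Matrix (Fin d) (Fin d) ℂ) (v : EuclideanSpace ℂ (Fin d)) :
    RCLike.re (inner (𝕜 := ℂ) (Matrix.toEuclideanCLM (𝕜 := ℂ) A v) v)
      = reTrace (Fin d) (A * Matrix.vecMulVec v.ofLp (star v.ofLp)) := by
  rw [← inner_conj_symm, RCLike.conj_re, EuclideanSpace.inner_eq_star_dotProduct,
    Matrix.ofLp_toEuclideanCLM, Matrix.mul_vecMulVec, reTrace_apply, Matrix.trace_vecMulVec]
  rfl

theorem exp_le_reTrace_exp {d : ℕ} {H : Matrix (Fin d) (Fin d) ℂ} (hH : IsSelfAdjoint H)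
    {v : EuclideanSpace ℂ (Fin d)} (hv : ‖v‖ = 1) {c : ℝ}
    (hc : c ≤ RCLike.re (inner (𝕜 := ℂ) (Matrix.toEuclideanCLM (𝕜 := ℂ) H v) v)) :
    Real.exp c ≤ reTrace (Fin d) (exp H) := by
  set Q := Matrix.vecMulVec v.ofLp (star v.ofLp) with hQ
  have hQ0 : 0 ≤ Q := (Matrix.posSemidef_vecMulVec_self_star v.ofLp).nonneg
  have hvv : star v.ofLp ⬝ᵥ v.ofLp = 1 := by
    have := inner_self_eq_norm_sq_to_K (𝕜 := ℂ) v
    rw [hv, EuclideanSpace.inner_eq_star_dotProduct, dotProduct_comm] at this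
    simpa using this
  have hQQ : Q * Q = Q := by
    rw [hQ, Matrix.vecMulVec_mul_vecMulVec, hvv, one_smul]
  have htQ : reTrace (Fin d) Q = 1 := by
    rw [reTrace_apply, hQ, Matrix.trace_vecMulVec, dotProduct_comm, hvv, Complex.one_re]
  have hsa : IsSelfAdjoint Q := .of_nonneg hQ0
  have h1Q : 0 ≤ 1 - Q := by
    have : 1 - Q = star (1 - Q) * (1 - Q) := by
      rw [star_sub, star_one, hsa.star_eq, sub_mul, mul_sub, mul_sub, hQQ]; simp
    rw [this]
    exact star_mul_self_nonneg _
  have h1 := reTrace_mul_nonneg (Matrix.exp_nonneg_of_isSelfAdjoint hH) h1Q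
  have h2 := reTrace_mul_le_mul_left hQ0 (Matrix.smul_one_add_le_exp hH c)
  rw [re_inner_eq_reTrace, ← hQ, reTrace_mul_comm] at hc
  rw [mul_sub, mul_one, map_sub, reTrace_mul_comm] at h1
  rw [mul_smul_comm, mul_add, mul_smul_comm, mul_one, map_smul, map_add, map_smul, htQ,
    smul_eq_mul, smul_eq_mul, mul_one] at h2
  have h3 : Real.exp c * 1 ≤ Real.exp c * (1 - c + reTrace (Fin d) (Q * H)) := by
    gcongr; linarith
  linarith

theorem reTrace_exp_add_le {H X V : Matrix m m ℂ} {M l : ℝ} (hH : IsSelfAdjoint H)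
    (hX : IsSelfAdjoint X) (hXM : ‖X‖ ≤ M) (hV : 0 ≤ V) (hVM : ‖V‖ ≤ M ^ 2) (hl : 0 ≤ l)
    (hM : 0 ≤ M) (hlM : 2 * (l * M) ≤ 1) :
    reTrace m (exp (H + (l • X - (2 * l ^ 2) • V)))
      ≤ reTrace m ((l • exp H - (2 * l ^ 3) • (V * exp H) - (2 * l ^ 3) • (exp H * V)) * X)
        + l ^ 2 * reTrace m (exp H * (X * X))
        + reTrace m (exp H - (2 * l ^ 2) • (exp H * V) + (4 * l ^ 4) • (exp H * (V * V))) := by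
  have hlM0 : 0 ≤ l * M := mul_nonneg hl hM
  have hBsa : IsSelfAdjoint (l • X - (2 * l ^ 2) • V) :=
    ((IsSelfAdjoint.all l).smul hX).sub ((IsSelfAdjoint.all (2 * l ^ 2)).smul (.of_nonneg hV))
  have hBn : ‖l • X - (2 * l ^ 2) • V‖ ≤ 1 := by
    refine (norm_sub_le _ _).trans ?_
    rw [norm_smul, norm_smul, Real.norm_of_nonneg hl, Real.norm_of_nonneg (by positivity)]
    have h1 : l * ‖X‖ ≤ l * M := by gcongr
    have h2 : 2 * l ^ 2 * ‖V‖ ≤ 2 * l ^ 2 * M ^ 2 := by gcongr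
    nlinarith
  refine (Matrix.re_trace_exp_add_le hH hBsa).trans ?_
  rw [← reTrace_apply]
  refine (reTrace_mul_le_mul_left (Matrix.exp_nonneg_of_isSelfAdjoint hH)
    (Matrix.exp_le_one_add_add_mul_self hBsa hBn)).trans (le_of_eq ?_)
  generalize exp H = G
  have e1 : reTrace m (G * (X * V)) = reTrace m (V * G * X) := by
    rw [← mul_assoc, reTrace_mul_comm, mul_assoc]
  have e2 : reTrace m (G * (V * X)) = reTrace m (G * V * X) := by
    rw [mul_assoc]
  simp only [mul_add, mul_sub, sub_mul, mul_one, map_add, map_sub, map_smul,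
    smul_mul_assoc, mul_smul_comm, smul_eq_mul, e1, e2]
  ring

theorem reTrace_compensated_le {G V : Matrix m m ℂ} {M l : ℝ} (hG : 0 ≤ G) (hV : 0 ≤ V)
    (hVM : ‖V‖ ≤ M ^ 2) (hl : 0 ≤ l) (hM : 0 ≤ M) (hlM : 2 * (l * M) ≤ 1) :
    l ^ 2 * reTrace m (G * V)
      + reTrace m (G - (2 * l ^ 2) • (G * V) + (4 * l ^ 4) • (G * (V * V))) ≤ reTrace m G := by
  have h1 := reTrace_mul_le_mul_left hG (Matrix.mul_self_le_norm_smul hV)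
  have h2 := reTrace_mul_nonneg hG hV
  rw [mul_smul_comm, map_smul, smul_eq_mul] at h1
  have h3 : reTrace m (G * (V * V)) ≤ M ^ 2 * reTrace m (G * V) :=
    h1.trans (mul_le_mul_of_nonneg_right hVM h2)
  simp only [map_add, map_sub, map_smul, smul_eq_mul]
  have h4 : 4 * l ^ 4 * reTrace m (G * (V * V))
      ≤ 4 * l ^ 4 * (M ^ 2 * reTrace m (G * V)) := by gcongr
  have h5 : (2 * (l * M)) ^ 2 ≤ 1 := pow_le_one₀ (by positivity) hlM
  have h6 : 0 ≤ l ^ 2 * reTrace m (G * V) := by positivity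
  nlinarith [mul_le_mul_of_nonneg_right h5 h6]

end MatrixOrder

section ConditionalStep

open NormedSpace

variable {Ω : Type*} {m0 : MeasurableSpace Ω} {μ : Measure Ω} [IsProbabilityMeasure μ]
  {m : Type*} [Fintype m] [DecidableEq m]

omit [IsProbabilityMeasure μ] in
theorem MeasureTheory.MemLp.exists_ae_norm_le {E : Type*} [NormedAddCommGroup E] {f : Ω → E}
    (hf : MemLp f ⊤ μ) : ∃ C : ℝ, ∀ᵐ ω ∂μ, ‖f ω‖ ≤ C := by
  refine ⟨(eLpNorm f ⊤ μ).toReal, ?_⟩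
  have h := ae_le_eLpNormEssSup (f := f) (μ := μ)
  rw [← eLpNorm_exponent_top] at h
  filter_upwards [h] with ω hω
  have := ENNReal.toReal_mono hf.2.ne hω
  simpa using this

omit [IsProbabilityMeasure μ] in
theorem MeasureTheory.MemLp.matrix_mul {f g : Ω → Matrix m m ℂ} (hf : MemLp f ⊤ μ)
    (hg : MemLp g ⊤ μ) : MemLp (fun ω => f ω * g ω) ⊤ μ := by
  obtain ⟨C, hC⟩ := hf.exists_ae_norm_le
  obtain ⟨D, hD⟩ := hg.exists_ae_norm_le
  refine memLp_top_of_bound (hf.1.mul hg.1) (C * D) ?_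
  filter_upwards [hC, hD] with ω h1 h2
  exact (norm_mul_le _ _).trans
    (mul_le_mul h1 h2 (norm_nonneg _) ((norm_nonneg _).trans h1))

omit [IsProbabilityMeasure μ] in
theorem MeasureTheory.MemLp.matrix_add {f g : Ω → Matrix m m ℂ} (hf : MemLp f ⊤ μ)
    (hg : MemLp g ⊤ μ) : MemLp (fun ω => f ω + g ω) ⊤ μ :=
  hf.add hg

omit [IsProbabilityMeasure μ] in
theorem MeasureTheory.MemLp.matrix_sub {f g : Ω → Matrix m m ℂ} (hf : MemLp f ⊤ μ)
    (hg : MemLp g ⊤ μ) : MemLp (fun ω => f ω - g ω) ⊤ μ :=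
  hf.sub hg

omit [IsProbabilityMeasure μ] in
theorem MeasureTheory.MemLp.matrix_smul {f : Ω → Matrix m m ℂ} (hf : MemLp f ⊤ μ) (c : ℝ) :
    MemLp (fun ω => c • f ω) ⊤ μ :=
  hf.const_smul c

theorem Matrix.continuous_exp : Continuous (exp : Matrix m m ℂ → Matrix m m ℂ) := by
  let _ : NormedAlgebra ℚ (Matrix m m ℂ) := NormedAlgebra.restrictScalars ℚ ℝ _
  exact exp_continuous

omit [IsProbabilityMeasure μ] in
theorem MeasureTheory.MemLp.matrix_exp {f : Ω → Matrix m m ℂ} (hf : MemLp f ⊤ μ) :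
    MemLp (fun ω => exp (f ω)) ⊤ μ := by
  obtain ⟨C, hC⟩ := hf.exists_ae_norm_le
  refine memLp_top_of_bound (Matrix.continuous_exp.comp_aestronglyMeasurable hf.1)
    (Real.exp C) ?_
  filter_upwards [hC] with ω h1
  cases isEmpty_or_nonempty m
  · rw [Subsingleton.elim (exp (f ω)) 0, norm_zero]
    exact Real.exp_nonneg _
  · exact (norm_exp_le_real_exp_norm _).trans (Real.exp_le_exp.mpr h1)

theorem MeasureTheory.MemLp.integrable_reTrace {f : Ω → Matrix m m ℂ} (hf : MemLp f ⊤ μ) :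
    Integrable (fun ω => reTrace m (f ω)) μ :=
  (reTrace m).integrable_comp (hf.integrable le_top)

theorem MeasureTheory.MemLp.integral_reTrace {f : Ω → Matrix m m ℂ} (hf : MemLp f ⊤ μ) :
    ∫ ω, reTrace m (f ω) ∂μ = reTrace m (∫ ω, f ω ∂μ) :=
  (reTrace m).integral_comp_comm (hf.integrable le_top)

theorem integral_mul_condExp {F : MeasurableSpace Ω} (hF : F ≤ m0) {K Y : Ω → Matrix m m ℂ}
    (hKm : StronglyMeasurable[F] K) (hK : MemLp K ⊤ μ) (hY : MemLp Y ⊤ μ) :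
    ∫ ω, K ω * Y ω ∂μ = ∫ ω, K ω * (μ[Y | F]) ω ∂μ := by
  have h := condExp_bilin_of_stronglyMeasurable_left (m := F) (μ := μ)
    (ContinuousLinearMap.mul ℝ (Matrix m m ℂ)) (f := K) (g := Y) hKm
    ((hK.matrix_mul hY).integrable le_top) (hY.integrable le_top)
  have h2 := integral_condExp hF (μ := μ) (f := fun ω => K ω * Y ω)
  rw [← h2]
  exact integral_congr_ae h

theorem ae_condExp_mul_self_bounds {F : MeasurableSpace Ω} (hF : F ≤ m0)
    {X : Ω → Matrix m m ℂ} {M : ℝ} (hX : MemLp X ⊤ μ) (hXsa : ∀ ω, IsSelfAdjoint (X ω))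
    (hXM : ∀ᵐ ω ∂μ, ‖X ω‖ ≤ M) :
    ∀ᵐ ω ∂μ, 0 ≤ (μ[fun ω => X ω * X ω | F]) ω ∧ ‖(μ[fun ω => X ω * X ω | F]) ω‖ ≤ M ^ 2 := by
  have h0 : 0 ≤ᵐ[μ] μ[fun ω => X ω * X ω | F] := by
    refine condExp_nonneg (Filter.Eventually.of_forall fun ω => ?_)
    have := star_mul_self_nonneg (X ω)
    rwa [(hXsa ω).star_eq] at this
  have h1 := norm_condExp_le (m := F) (μ := μ) (fun ω => X ω * X ω)
  have h2 : μ[fun ω => ‖X ω * X ω‖ | F] ≤ᵐ[μ] μ[fun _ => M ^ 2 | F] := by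
    refine condExp_mono ((hX.matrix_mul hX).integrable le_top).norm (integrable_const _) ?_
    filter_upwards [hXM] with ω hω
    rw [pow_two]
    exact (norm_mul_le _ _).trans (mul_le_mul hω hω (norm_nonneg _) ((norm_nonneg _).trans hω))
  rw [condExp_const hF] at h2
  filter_upwards [h0, h1, h2] with ω a b c
  exact ⟨a, b.trans c⟩

theorem integral_reTrace_exp_add_le {F : MeasurableSpace Ω} (hF : F ≤ m0)
    {H X : Ω → Matrix m m ℂ} {M l : ℝ} (hHm : StronglyMeasurable[F] H) (hH : MemLp H ⊤ μ)
    (hHsa : ∀ᵐ ω ∂μ, IsSelfAdjoint (H ω)) (hX : MemLp X ⊤ μ) (hXsa : ∀ ω, IsSelfAdjoint (X ω))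
    (hXM : ∀ᵐ ω ∂μ, ‖X ω‖ ≤ M) (hXF : μ[X | F] =ᵐ[μ] 0) (hl : 0 ≤ l) (hM : 0 ≤ M)
    (hlM : 2 * (l * M) ≤ 1) :
    ∫ ω, reTrace m (exp (H ω + (l • X ω - (2 * l ^ 2) • (μ[fun ω => X ω * X ω | F]) ω))) ∂μ
      ≤ ∫ ω, reTrace m (exp (H ω)) ∂μ := by
  have hVb := ae_condExp_mul_self_bounds hF hX hXsa hXM
  have hXX : MemLp (fun ω => X ω * X ω) ⊤ μ := hX.matrix_mul hX
  set V := μ[fun ω => X ω * X ω | F] with hVdef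
  have hVm : StronglyMeasurable[F] V := stronglyMeasurable_condExp
  have hV : MemLp V ⊤ μ := memLp_top_of_bound (hVm.mono hF).aestronglyMeasurable (M ^ 2)
    (hVb.mono fun ω h => h.2)
  set G : Ω → Matrix m m ℂ := fun ω => exp (H ω) with hGdef
  have hGm : StronglyMeasurable[F] G := Matrix.continuous_exp.comp_stronglyMeasurable hHm
  have hG : MemLp G ⊤ μ := hH.matrix_exp
  set K₁ : Ω → Matrix m m ℂ :=
    fun ω => l • G ω - (2 * l ^ 3) • (V ω * G ω) - (2 * l ^ 3) • (G ω * V ω) with hK₁def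
  have hK₁m : StronglyMeasurable[F] K₁ := by
    have hc : Continuous fun p : Matrix m m ℂ × Matrix m m ℂ =>
        l • p.1 - (2 * l ^ 3) • (p.2 * p.1) - (2 * l ^ 3) • (p.1 * p.2) := by fun_prop
    exact hc.comp_stronglyMeasurable (hGm.prodMk hVm)
  have hK₁ : MemLp K₁ ⊤ μ :=
    ((hG.matrix_smul l).matrix_sub ((hV.matrix_mul hG).matrix_smul (2 * l ^ 3))).matrix_sub
      ((hG.matrix_mul hV).matrix_smul (2 * l ^ 3))
  set R : Ω → Matrix m m ℂ :=
    fun ω => G ω - (2 * l ^ 2) • (G ω * V ω) + (4 * l ^ 4) • (G ω * (V ω * V ω)) with hRdef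
  have hR : MemLp R ⊤ μ :=
    (hG.matrix_sub ((hG.matrix_mul hV).matrix_smul (2 * l ^ 2))).matrix_add
      ((hG.matrix_mul (hV.matrix_mul hV)).matrix_smul (4 * l ^ 4))
  have int {f : Ω → Matrix m m ℂ} (hf : MemLp f ⊤ μ) := hf.integrable_reTrace
  have swap {f : Ω → Matrix m m ℂ} (hf : MemLp f ⊤ μ) := hf.integral_reTrace
  have hB : MemLp (fun ω => H ω + (l • X ω - (2 * l ^ 2) • V ω)) ⊤ μ :=
    hH.matrix_add ((hX.matrix_smul l).matrix_sub (hV.matrix_smul (2 * l ^ 2)))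
  calc _ ≤ ∫ ω, (reTrace m (K₁ ω * X ω) + l ^ 2 * reTrace m (G ω * (X ω * X ω))
          + reTrace m (R ω)) ∂μ := by
        refine integral_mono_ae (int hB.matrix_exp)
          (((int (hK₁.matrix_mul hX)).add ((int (hG.matrix_mul hXX)).const_mul _)).add (int hR)) ?_
        filter_upwards [hVb, hXM, hHsa] with ω hVω hXω hHω
        exact reTrace_exp_add_le hHω (hXsa ω) hXω hVω.1 hVω.2 hl hM hlM
    _ = ∫ ω, (l ^ 2 * reTrace m (G ω * V ω) + reTrace m (R ω)) ∂μ := by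
        have h1 : ∫ ω, reTrace m (K₁ ω * X ω) ∂μ = 0 := by
          rw [swap (hK₁.matrix_mul hX), integral_mul_condExp hF hK₁m hK₁ hX]
          have : ∫ ω, K₁ ω * (μ[X | F]) ω ∂μ = ∫ _, (0 : Matrix m m ℂ) ∂μ :=
            integral_congr_ae (hXF.mono fun ω h => by simp [h])
          rw [this, integral_zero, map_zero]
        have h2 : ∫ ω, reTrace m (G ω * (X ω * X ω)) ∂μ = ∫ ω, reTrace m (G ω * V ω) ∂μ := by
          rw [swap (hG.matrix_mul hXX), swap (hG.matrix_mul hV),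
            integral_mul_condExp hF hGm hG hXX]
        have i1 := int (hK₁.matrix_mul hX)
        have i2 : Integrable (fun ω => l ^ 2 * reTrace m (G ω * (X ω * X ω))) μ :=
          (int (hG.matrix_mul hXX)).const_mul _
        have i3 : Integrable (fun ω => reTrace m (K₁ ω * X ω)
            + l ^ 2 * reTrace m (G ω * (X ω * X ω))) μ := i1.add i2
        have i4 : Integrable (fun ω => l ^ 2 * reTrace m (G ω * V ω)) μ :=
          (int (hG.matrix_mul hV)).const_mul _
        rw [integral_add i3 (int hR), integral_add i1 i2, integral_add i4 (int hR),
          integral_const_mul, integral_const_mul, h1, h2, zero_add]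
    _ ≤ _ := by
        refine integral_mono_ae (((int (hG.matrix_mul hV)).const_mul _).add (int hR)) (int hG) ?_
        filter_upwards [hVb, hHsa] with ω hVω hHω
        exact reTrace_compensated_le (Matrix.exp_nonneg_of_isSelfAdjoint hHω) hVω.1 hVω.2 hl hM hlM

end ConditionalStep

section Tail

open NormedSpace

variable {Ω : Type*} {m0 : MeasurableSpace Ω} {μ : Measure Ω} [IsProbabilityMeasure μ]

/-- The compensated sum `∑ (l D_i - 2 l² E[D_i² | F_i])`. -/
noncomputable def compensatedSum (μ : Measure Ω) {m : Type*} [Fintype m] [DecidableEq m]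
    (F : ℕ → MeasurableSpace Ω) (D : ℕ → Ω → Matrix m m ℂ) (l : ℝ) (k : ℕ) (ω : Ω) :
    Matrix m m ℂ :=
  ∑ i ∈ Finset.range k, (l • D i ω - (2 * l ^ 2) • (μ[fun ω => D i ω * D i ω | F i]) ω)

theorem compensatedSum_spec {m : Type*} [Fintype m] [DecidableEq m] {n : ℕ}
    {F : ℕ → MeasurableSpace Ω} (hF_le : ∀ i, F i ≤ m0) (hF_mono : Monotone F)
    {D : ℕ → Ω → Matrix m m ℂ} {M l : ℝ} (hDm : ∀ i < n, StronglyMeasurable[F (i + 1)] (D i))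
    (hDsa : ∀ i ω, IsSelfAdjoint (D i ω)) (hDM : ∀ i < n, ∀ᵐ ω ∂μ, ‖D i ω‖ ≤ M)
    (hDF : ∀ i < n, μ[D i | F i] =ᵐ[μ] 0) (hl : 0 ≤ l) (hM : 0 ≤ M) (hlM : 2 * (l * M) ≤ 1)
    {k : ℕ} (hk : k ≤ n) :
    StronglyMeasurable[F k] (compensatedSum μ F D l k) ∧
      MemLp (compensatedSum μ F D l k) ⊤ μ ∧
      (∀ᵐ ω ∂μ, IsSelfAdjoint (compensatedSum μ F D l k ω)) ∧
      ∫ ω, reTrace m (exp (compensatedSum μ F D l k ω)) ∂μ ≤ Fintype.card m := by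
  induction k with
  | zero =>
    have h0 : compensatedSum μ F D l 0 = fun _ => 0 := by
      funext ω; simp [compensatedSum]
    rw [h0]
    refine ⟨stronglyMeasurable_const, memLp_const _, Filter.Eventually.of_forall fun _ =>
      IsSelfAdjoint.zero _, ?_⟩
    simp [reTrace_apply, Matrix.trace_one]
  | succ k ih =>
    have hkn : k < n := hk
    obtain ⟨ihm, ihL, ihsa, ihi⟩ := ih hkn.le
    have hD : MemLp (D k) ⊤ μ :=
      memLp_top_of_bound ((hDm k hkn).mono (hF_le _)).aestronglyMeasurable M (hDM k hkn)
    have hVb := ae_condExp_mul_self_bounds (hF_le k) hD (hDsa k) (hDM k hkn)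
    have hVm : StronglyMeasurable[F k] (μ[fun ω => D k ω * D k ω | F k]) :=
      stronglyMeasurable_condExp
    have hV : MemLp (μ[fun ω => D k ω * D k ω | F k]) ⊤ μ :=
      memLp_top_of_bound (hVm.mono (hF_le k)).aestronglyMeasurable (M ^ 2)
        (hVb.mono fun ω h => h.2)
    have hstep := integral_reTrace_exp_add_le (hF_le k) ihm ihL ihsa hD (hDsa k) (hDM k hkn)
      (hDF k hkn) hl hM hlM
    have hs : compensatedSum μ F D l (k + 1) = fun ω => compensatedSum μ F D l k ω
        + (l • D k ω - (2 * l ^ 2) • (μ[fun ω => D k ω * D k ω | F k]) ω) := by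
      funext ω; simp only [compensatedSum, Finset.sum_range_succ]
    rw [hs]
    generalize μ[fun ω => D k ω * D k ω | F k] = V at *
    refine ⟨?_, ihL.matrix_add ((hD.matrix_smul l).matrix_sub (hV.matrix_smul (2 * l ^ 2))), ?_,
      hstep.trans ihi⟩
    · have hc : Continuous fun p : Matrix m m ℂ × Matrix m m ℂ × Matrix m m ℂ =>
          p.1 + (l • p.2.1 - (2 * l ^ 2) • p.2.2) := by fun_prop
      exact hc.comp_stronglyMeasurable ((ihm.mono (hF_mono k.le_succ)).prodMk
        ((hDm k hkn).prodMk (hVm.mono (hF_mono k.le_succ))))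
    · filter_upwards [ihsa, hVb] with ω h1 h2
      exact h1.add (((IsSelfAdjoint.all l).smul (hDsa k ω)).sub
        ((IsSelfAdjoint.all (2 * l ^ 2)).smul (.of_nonneg h2.1)))

theorem bddAbove_range_rayleigh {d : ℕ} (A : Matrix (Fin d) (Fin d) ℂ) :
    BddAbove (Set.range fun v : {v : EuclideanSpace ℂ (Fin d) // ‖v‖ = 1} =>
      RCLike.re (inner (𝕜 := ℂ) (Matrix.toEuclideanCLM (𝕜 := ℂ) A v.1) v.1)) := by
  refine ⟨‖Matrix.toEuclideanCLM (𝕜 := ℂ) A‖, ?_⟩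
  rintro _ ⟨⟨v, hv⟩, rfl⟩
  refine (re_inner_le_norm _ _).trans ?_
  simpa [hv] using (Matrix.toEuclideanCLM (𝕜 := ℂ) A).le_opNorm v

theorem exp_le_reTrace_exp_of_lamMax {d : ℕ} {Z W : Matrix (Fin d) (Fin d) ℂ} {l t s : ℝ}
    (hl : 0 ≤ l) (ht : 0 < t) (hsa : IsSelfAdjoint (l • Z - (2 * l ^ 2) • W))
    (hZ : t ≤ lamMax Z) (hW : lamMax W ≤ s) :
    Real.exp (l * t - 2 * l ^ 2 * s) ≤ reTrace (Fin d) (exp (l • Z - (2 * l ^ 2) • W)) := by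
  have hc : Continuous fun r : ℝ => Real.exp (l * r - 2 * l ^ 2 * s) := by fun_prop
  refine le_of_tendsto ((hc.tendsto t).mono_left (nhdsWithin_le_nhds (s := Set.Iio t))) ?_
  filter_upwards [self_mem_nhdsWithin] with r hr
  have hne : Nonempty {v : EuclideanSpace ℂ (Fin d) // ‖v‖ = 1} := by
    by_contra h
    rw [not_nonempty_iff] at h
    rw [lamMax, Real.iSup_of_isEmpty] at hZ
    linarith
  obtain ⟨⟨v, hv⟩, hvr⟩ := exists_lt_of_lt_ciSup (lt_of_lt_of_le (Set.mem_Iio.mp hr) hZ)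
  have hvW := (le_ciSup (bddAbove_range_rayleigh W) ⟨v, hv⟩).trans hW
  refine exp_le_reTrace_exp hsa hv ?_
  simp only [re_inner_eq_reTrace] at hvr hvW ⊢
  rw [sub_mul, smul_mul_assoc, smul_mul_assoc, map_sub, map_smul, map_smul, smul_eq_mul,
    smul_eq_mul]
  gcongr

theorem measure_lamMax_sum_le {d n : ℕ}
    {F : ℕ → MeasurableSpace Ω} (hF_le : ∀ i, F i ≤ m0) (hF_mono : Monotone F)
    {D : ℕ → Ω → Matrix (Fin d) (Fin d) ℂ} {M : ℝ}
    (hDm : ∀ i < n, StronglyMeasurable[F (i + 1)] (D i))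
    (hDsa : ∀ i ω, IsSelfAdjoint (D i ω)) (hDM : ∀ i < n, ∀ᵐ ω ∂μ, ‖D i ω‖ ≤ M)
    (hDF : ∀ i < n, μ[D i | F i] =ᵐ[μ] 0) (hM : 0 ≤ M) {t σ : ℝ} (ht : 0 < t) (hσ : 0 < σ) :
    μ.real {ω | t ≤ lamMax (∑ i ∈ Finset.range n, D i ω) ∧
        lamMax (∑ i ∈ Finset.range n, (μ[fun ω => D i ω * D i ω | F i]) ω) ≤ σ ^ 2}
      ≤ d * Real.exp (-t ^ 2 / (8 * σ ^ 2 + 4 * M * t)) := by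
  have hden : 0 < 4 * σ ^ 2 + 2 * M * t := by positivity
  set l : ℝ := t / (4 * σ ^ 2 + 2 * M * t) with hldef
  have hl : 0 ≤ l := by positivity
  have hlden : l * (4 * σ ^ 2 + 2 * M * t) = t := div_mul_cancel₀ _ hden.ne'
  have hlM : 2 * (l * M) ≤ 1 := by
    rw [hldef, div_mul_eq_mul_div, ← mul_div_assoc, div_le_one hden]
    nlinarith [sq_nonneg σ]
  obtain ⟨-, hL, hsa, hint⟩ := compensatedSum_spec hF_le hF_mono hDm hDsa hDM hDF hl hM hlM le_rfl
  set ε := Real.exp (l * t - 2 * l ^ 2 * σ ^ 2) with hε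
  have hmarkov := mul_meas_ge_le_integral_of_nonneg (μ := μ)
    (hsa.mono fun ω h => reTrace_nonneg (Matrix.exp_nonneg_of_isSelfAdjoint h))
    hL.matrix_exp.integrable_reTrace ε
  rw [Fintype.card_fin] at hint
  have hsub : μ.real {ω | t ≤ lamMax (∑ i ∈ Finset.range n, D i ω) ∧
        lamMax (∑ i ∈ Finset.range n, (μ[fun ω => D i ω * D i ω | F i]) ω) ≤ σ ^ 2}
      ≤ μ.real {ω | ε ≤ reTrace (Fin d) (exp (compensatedSum μ F D l n ω))} := by
    refine ENNReal.toReal_mono (measure_ne_top _ _) (measure_mono_ae ?_)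
    filter_upwards [hsa] with ω hω ⟨h1, h2⟩
    have hs : compensatedSum μ F D l n ω = l • ∑ i ∈ Finset.range n, D i ω
        - (2 * l ^ 2) • ∑ i ∈ Finset.range n, (μ[fun ω => D i ω * D i ω | F i]) ω := by
      rw [compensatedSum, Finset.sum_sub_distrib, Finset.smul_sum, Finset.smul_sum]
    rw [hs] at hω
    change ε ≤ reTrace (Fin d) (exp (compensatedSum μ F D l n ω))
    rw [hs]
    exact exp_le_reTrace_exp_of_lamMax hl ht hω h1 h2
  have hexp : -(l * t - 2 * l ^ 2 * σ ^ 2) ≤ -t ^ 2 / (8 * σ ^ 2 + 4 * M * t) := by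
    have e : -t ^ 2 / (8 * σ ^ 2 + 4 * M * t) = -(l * t) / 2 := by
      rw [hldef]; field_simp; ring
    rw [e]
    have h2 : l * (l * (4 * σ ^ 2 + 2 * M * t)) = l * t := by rw [hlden]
    have h3 : 0 ≤ l * (l * (M * t)) := by positivity
    nlinarith
  have hεpos : 0 < ε := Real.exp_pos _
  calc _ ≤ μ.real {ω | ε ≤ reTrace (Fin d) (exp (compensatedSum μ F D l n ω))} := hsub
    _ ≤ d / ε := by
        rw [le_div_iff₀ hεpos, mul_comm]
        exact hmarkov.trans hint
    _ = d * Real.exp (-(l * t - 2 * l ^ 2 * σ ^ 2)) := by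
        rw [Real.exp_neg, div_eq_mul_inv]
    _ ≤ _ := by gcongr

omit [IsProbabilityMeasure μ] in
/-- Conditional expectations of matrices may be computed entrywise. -/
theorem condExp_matrix_apply {m : Type*} [Fintype m] [DecidableEq m] {F : MeasurableSpace Ω}
    {f : Ω → Matrix m m ℂ} (hf : Integrable f μ) :
    ∀ᵐ ω ∂μ, ∀ a b, (μ[f | F]) ω a b = (μ[fun ω => f ω a b | F]) ω := by
  rw [ae_all_iff]; intro a
  rw [ae_all_iff]; intro b
  let T : Matrix m m ℂ →L[ℝ] ℂ :=
    { toFun := fun A => A a b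
      map_add' := fun _ _ => rfl
      map_smul' := fun _ _ => rfl
      cont := continuous_id.matrix_elem a b }
  exact T.comp_condExp_comm hf

theorem stronglyMeasurable_matrix {m : Type*} [Fintype m] [DecidableEq m] {F : MeasurableSpace Ω}
    {f : Ω → Matrix m m ℂ} (hf : ∀ a b, StronglyMeasurable[F] fun ω => f ω a b) :
    StronglyMeasurable[F] f := by
  have hc : Continuous fun p : m × m → ℂ => (Matrix.of fun a b => p (a, b) : Matrix m m ℂ) :=
    continuous_matrix fun a b => continuous_apply (a, b)
  exact hc.comp_stronglyMeasurable
    (measurable_pi_iff.mpr fun p => (hf p.1 p.2).measurable).stronglyMeasurable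

theorem measure_lamMax_martingale_le {d n : ℕ}
    {F : ℕ → MeasurableSpace Ω} (hF_le : ∀ i, F i ≤ m0) (hF_mono : Monotone F)
    {Z : ℕ → Ω → Matrix (Fin d) (Fin d) ℂ} (hZ0 : ∀ ω, Z 0 ω = 0)
    (hZherm : ∀ i ω, (Z i ω).IsHermitian)
    (hZadapted : ∀ i, i ≤ n → ∀ a b, StronglyMeasurable[F i] (fun ω => Z i ω a b))
    (hZint : ∀ i, i ≤ n → ∀ a b, Integrable (fun ω => Z i ω a b) μ)
    (hZmart : ∀ i, 1 ≤ i → i ≤ n → ∀ a b,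
      μ[(fun ω => Z i ω a b) | F (i - 1)] =ᵐ[μ] fun ω => Z (i - 1) ω a b)
    {M : ℝ} (hbdd : ∀ i, 1 ≤ i → i ≤ n → ∀ᵐ ω ∂μ, specNorm (Z i ω - Z (i - 1) ω) ≤ M)
    {t σ : ℝ} (ht : 0 < t) (hσ : 0 < σ) :
    μ.real {ω | t ≤ lamMax (Z n ω) ∧ lamMax (Matrix.of fun a b =>
      ∑ i ∈ Finset.Icc 1 n,
        (μ[(fun ω' => ((Z i ω' - Z (i - 1) ω') * (Z i ω' - Z (i - 1) ω')) a b)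
            | F (i - 1)]) ω) ≤ σ ^ 2}
      ≤ d * Real.exp (-t ^ 2 / (8 * σ ^ 2 + 4 * M * t)) := by
  rcases Nat.eq_zero_or_pos n with rfl | hn
  · have : {ω | t ≤ lamMax (Z 0 ω) ∧ lamMax (Matrix.of fun a b =>
      ∑ i ∈ Finset.Icc 1 0,
        (μ[(fun ω' => ((Z i ω' - Z (i - 1) ω') * (Z i ω' - Z (i - 1) ω')) a b)
            | F (i - 1)]) ω) ≤ σ ^ 2} = ∅ := by
      ext ω
      simp only [Set.mem_ofPred_eq, Set.mem_empty_iff_false, iff_false, not_and]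
      intro h
      have h0 : lamMax (Z 0 ω) = 0 := by simp [lamMax, hZ0]
      linarith
    rw [this, measureReal_empty]
    positivity
  have hM : 0 ≤ M := by
    obtain ⟨ω, hω⟩ := (hbdd 1 le_rfl hn).exists
    exact (norm_nonneg _).trans hω
  set D : ℕ → Ω → Matrix (Fin d) (Fin d) ℂ := fun i ω => Z (i + 1) ω - Z i ω with hD
  have hDm : ∀ i < n, StronglyMeasurable[F (i + 1)] (D i) := fun i hi =>
    stronglyMeasurable_matrix fun a b => (hZadapted (i + 1) hi a b).sub
      ((hZadapted i hi.le a b).mono (hF_mono i.le_succ))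
  have hDM : ∀ i < n, ∀ᵐ ω ∂μ, ‖D i ω‖ ≤ M := fun i hi => by
    have h := hbdd (i + 1) (by omega) hi
    simp only [Nat.add_sub_cancel] at h
    exact h
  have hDL : ∀ i < n, MemLp (D i) ⊤ μ := fun i hi =>
    memLp_top_of_bound ((hDm i hi).mono (hF_le _)).aestronglyMeasurable M (hDM i hi)
  have hDF : ∀ i < n, μ[D i | F i] =ᵐ[μ] 0 := fun i hi => by
    have hent : ∀ᵐ ω ∂μ, ∀ a b, (μ[fun ω => D i ω a b | F i]) ω = 0 := by
      rw [ae_all_iff]; intro a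
      rw [ae_all_iff]; intro b
      have h1 := condExp_sub (hZint (i + 1) hi a b) (hZint i hi.le a b) (F i)
      have h2 := hZmart (i + 1) (by omega) hi a b
      have h3 := condExp_of_stronglyMeasurable (hF_le i) (hZadapted i hi.le a b)
        (hZint i hi.le a b)
      rw [h3] at h1
      simp only [Nat.add_sub_cancel] at h2
      filter_upwards [h1, h2] with ω e1 e2
      refine e1.trans ?_
      rw [Pi.sub_apply, e2, sub_self]
    filter_upwards [condExp_matrix_apply (F := F i) ((hDL i hi).integrable le_top), hent]
      with ω h1 h2
    ext a b
    rw [h1, h2]; rfl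
  refine le_trans (ENNReal.toReal_mono (measure_ne_top _ _) (measure_mono_ae ?_))
    (measure_lamMax_sum_le hF_le hF_mono hDm
      (fun i ω => ((hZherm (i + 1) ω).sub (hZherm i ω))) hDM hDF hM ht hσ)
  have hall : ∀ᵐ ω ∂μ, ∀ i < n, ∀ a b, (μ[fun ω => D i ω * D i ω | F i]) ω a b
      = (μ[fun ω => (D i ω * D i ω) a b | F i]) ω := by
    rw [ae_all_iff]; intro i
    by_cases hi : i < n
    · filter_upwards [condExp_matrix_apply (F := F i)
        (((hDL i hi).matrix_mul (hDL i hi)).integrable le_top)] with ω h _ using h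
    · exact Filter.Eventually.of_forall fun ω h => absurd h hi
  filter_upwards [hall] with ω hω ⟨h1, h2⟩
  have hZn : ∑ i ∈ Finset.range n, D i ω = Z n ω := by
    simp only [hD]
    rw [Finset.sum_range_sub (fun i => Z i ω), hZ0, sub_zero]
  refine ⟨by rwa [hZn], ?_⟩
  convert h2 using 2
  ext a b
  rw [Matrix.sum_apply, Matrix.of_apply, show Finset.Icc 1 n = Finset.Ico 1 (n + 1) from rfl,
    Finset.sum_Ico_eq_sum_range, Nat.add_sub_cancel]
  refine Finset.sum_congr rfl fun i hi => ?_
  rw [hω i (Finset.mem_range.mp hi), Nat.add_comm 1 i, Nat.add_sub_cancel]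

end Tail

end Auxiliary

/-- **Freedman's inequality for matrix martingales.**
Let `0 = Z 0, Z 1, …, Z n` be random `d × d` Hermitian matrices forming a martingale
with respect to a filtration `F 0 ⊆ F 1 ⊆ … ⊆ F n`, with `‖Z i − Z (i−1)‖ ≤ M` a.s.
for `1 ≤ i ≤ n`, and let `W` be the predictable quadratic variation
`∑_{i=1}^n E[(Z i − Z (i−1))² | F (i−1)]`. Then for all `t, σ > 0`,
`P(λ_max (Z n) ≥ t ∧ λ_max W ≤ σ²) ≤ d · exp (−t² / (8σ² + 4Mt))`. -/
theorem freedman_matrix_martingale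
    {Ω : Type*} {m0 : MeasurableSpace Ω} {μ : Measure Ω} [IsProbabilityMeasure μ]
    {d n : ℕ}
    (F : ℕ → MeasurableSpace Ω) (hF_le : ∀ i, F i ≤ m0) (hF_mono : Monotone F)
    (Z : ℕ → Ω → Matrix (Fin d) (Fin d) ℂ)
    (hZ0 : ∀ ω, Z 0 ω = 0)
    (hZherm : ∀ i ω, (Z i ω).IsHermitian)
    (hZadapted : ∀ i, i ≤ n → ∀ a b, StronglyMeasurable[F i] (fun ω => Z i ω a b))
    (hZint : ∀ i, i ≤ n → ∀ a b, Integrable (fun ω => Z i ω a b) μ)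
    (hZmart : ∀ i, 1 ≤ i → i ≤ n → ∀ a b,
      μ[(fun ω => Z i ω a b) | F (i - 1)] =ᵐ[μ] fun ω => Z (i - 1) ω a b)
    (M : ℝ)
    (hbdd : ∀ i, 1 ≤ i → i ≤ n → ∀ᵐ ω ∂μ, specNorm (Z i ω - Z (i - 1) ω) ≤ M)
    (W : Ω → Matrix (Fin d) (Fin d) ℂ)
    (hW : W = fun ω => Matrix.of fun a b =>
      ∑ i ∈ Finset.Icc 1 n,
        (μ[(fun ω' => ((Z i ω' - Z (i - 1) ω') * (Z i ω' - Z (i - 1) ω')) a b)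
            | F (i - 1)]) ω)
    (t σ : ℝ) (ht : 0 < t) (hσ : 0 < σ) :
    (μ {ω | t ≤ lamMax (Z n ω) ∧ lamMax (W ω) ≤ σ ^ 2}).toReal
      ≤ d * Real.exp (-t ^ 2 / (8 * σ ^ 2 + 4 * M * t)) := by
  subst hW
  exact measure_lamMax_martingale_le hF_le hF_mono hZ0 hZherm hZadapted hZint hZmart hbdd ht hσ
end

section
/- Let V and W be compact self-adjoint bounded linear operators on a real Hilbert space H with ‖V − W‖ ≤ ε. Let S ⊆ ℝ be such that inf_{s ∈ S} |s| > ε. Then m_V(S) ≤ m_W(S^ε), where S^ε := {x ∈ ℝ : ∃ s ∈ S, |x − s| ≤ ε}. -/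
open scoped ENNReal

/-- Pythagoras' theorem for a convergent series along an orthogonal family. -/
theorem OrthogonalFamily.hasSum_norm_sq {ι E : Type*} [NormedAddCommGroup E]
    [InnerProductSpace ℝ E] {G : ι → Type*} [∀ i, NormedAddCommGroup (G i)]
    [∀ i, InnerProductSpace ℝ (G i)] {V : ∀ i, G i →ₗᵢ[ℝ] E} (hV : OrthogonalFamily ℝ G V)
    {w : ∀ i, G i} {x : E} (hx : HasSum (fun i => V i (w i)) x) :
    HasSum (fun i => ‖w i‖ ^ 2) (‖x‖ ^ 2) := by
  have hinner (i : ι) : inner ℝ x (V i (w i)) = ‖w i‖ ^ 2 := by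
    have h₁ := hx.mapL (innerSL ℝ (V i (w i)))
    have h₂ : HasSum (fun j => innerSL ℝ (V i (w i)) (V j (w j)))
        (innerSL ℝ (V i (w i)) (V i (w i))) :=
      hasSum_single i fun j hj => hV hj.symm (w i) (w j)
    rw [real_inner_comm]
    simpa using h₁.unique h₂
  have h := hx.mapL (innerSL ℝ x)
  simpa [hinner] using h

section Eigenspaces

variable {H : Type*} [NormedAddCommGroup H] [InnerProductSpace ℝ H]

theorem hasSum_apply_sub_smul_of_mem_eigenspace {T : H →L[ℝ] H} {ι : Type*} {μ : ι → ℝ}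
    {w : ∀ i, Module.End.eigenspace (T : H →ₗ[ℝ] H) (μ i)} {x : H}
    (hx : HasSum (fun i => (w i : H)) x) (c : ℝ) :
    HasSum (fun i => (((μ i - c) • w i : Module.End.eigenspace (T : H →ₗ[ℝ] H) (μ i)) : H))
      (T x - c • x) := by
  convert! (hx.mapL T).sub (hx.const_smul c) using 2 with i
  have := Module.End.mem_eigenspace_iff.mp (w i).2
  rw [ContinuousLinearMap.coe_coe] at this
  simp [this, sub_smul]

/-- A sum of eigenvectors whose eigenvalues are within `r` of `c` is moved by `T - c` by at most
`r` times its norm. -/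
theorem norm_apply_sub_smul_le_of_hasSum {T : H →L[ℝ] H} (hT : T.IsSymmetric) {ι : Type*}
    {μ : ι → ℝ} (hμ : Function.Injective μ) {c r : ℝ} (hr : 0 ≤ r) (hμr : ∀ i, |μ i - c| ≤ r)
    {w : ∀ i, Module.End.eigenspace (T : H →ₗ[ℝ] H) (μ i)} {x : H}
    (hx : HasSum (fun i => (w i : H)) x) :
    ‖T x - c • x‖ ≤ r * ‖x‖ := by
  have hfam := hT.orthogonalFamily_eigenspaces.comp hμ
  have h₁ := (hfam.hasSum_norm_sq (w := w) hx).mul_left (r ^ 2)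
  have h₂ := hfam.hasSum_norm_sq (w := fun i => (μ i - c) • w i)
    (hasSum_apply_sub_smul_of_mem_eigenspace hx c)
  rw [← mul_pow] at h₁
  refine le_of_sq_le_sq (hasSum_le (fun i => ?_) h₂ h₁) (by positivity)
  simp only [norm_smul, mul_pow, Real.norm_eq_abs]
  gcongr
  exact hμr i

variable [CompleteSpace H]

theorem exists_hasSum_mem_eigenspace {T : H →L[ℝ] H} (hTc : IsCompactOperator T)
    (hT : T.IsSymmetric) (x : H) :
    ∃ w : ∀ μ : ℝ, Module.End.eigenspace (T : H →ₗ[ℝ] H) μ, HasSum (fun μ => (w μ : H)) x := by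
  have hcomplete (μ : ℝ) : CompleteSpace (Module.End.eigenspace (T : H →ₗ[ℝ] H) μ) :=
    (ContinuousLinearMap.isClosed_eigenspace (f := T) (μ := μ)).completeSpace_coe
  have hsum := IsHilbertSum.mkInternal (F := fun μ => Module.End.eigenspace (T : H →ₗ[ℝ] H) μ)
    hT.orthogonalFamily_eigenspaces (by
      rw [Submodule.topologicalClosure_eq_top_iff.mpr
        (ContinuousLinearMap.orthogonalComplement_iSup_eigenspaces_eq_bot hTc hT)])
  exact ⟨hsum.linearIsometryEquiv x, by
    simpa using hsum.hasSum_linearIsometryEquiv_symm (hsum.linearIsometryEquiv x)⟩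

/-- A nonzero vector orthogonal to all eigenvectors with eigenvalues within `r` of `c` is moved by
`T - c` by more than `r` times its norm. -/
theorem lt_norm_apply_sub_smul_of_mem_orthogonal {T : H →L[ℝ] H} (hTc : IsCompactOperator T)
    (hT : T.IsSymmetric) {c r : ℝ} (hr : 0 ≤ r) {x : H} (hx0 : x ≠ 0)
    (hx : ∀ μ, |μ - c| ≤ r → x ∈ (Module.End.eigenspace (T : H →ₗ[ℝ] H) μ)ᗮ) :
    r * ‖x‖ < ‖T x - c • x‖ := by
  obtain ⟨w, hw⟩ := exists_hasSum_mem_eigenspace hTc hT x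
  have hfam := hT.orthogonalFamily_eigenspaces
  have hw0 (μ : ℝ) (hμ : |μ - c| ≤ r) : w μ = 0 := by
    have h₁ := hw.mapL (innerSL ℝ (w μ : H))
    have h₂ : HasSum (fun ν => innerSL ℝ (w μ : H) (w ν : H))
        (innerSL ℝ (w μ : H) (w μ : H)) :=
      hasSum_single μ fun ν hν => hfam hν.symm (w μ) (w ν)
    have h₃ := h₂.unique h₁
    have h₄ : inner ℝ (w μ : H) x = 0 := hx μ hμ _ (w μ).2
    simpa [h₄] using h₃
  have h₁ := (hfam.hasSum_norm_sq (w := w) hw).mul_left (r ^ 2)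
  have h₂ := hfam.hasSum_norm_sq (w := fun μ => (μ - c) • w μ)
    (hasSum_apply_sub_smul_of_mem_eigenspace (μ := fun μ => μ) hw c)
  obtain ⟨ν, hν⟩ : ∃ ν, w ν ≠ 0 := by
    by_contra! h
    simp only [h] at hw
    exact hx0 (hw.unique (by simp))
  rw [← mul_pow] at h₁
  refine lt_of_pow_lt_pow_left₀ 2 (norm_nonneg _)
    (hasSum_lt (i := ν) (fun μ => ?_) ?_ h₁ h₂)
  · by_cases hμ : |μ - c| ≤ r
    · simp [hw0 μ hμ]
    · simp only [norm_smul, mul_pow, Real.norm_eq_abs]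
      gcongr
      exact (not_le.mp hμ).le
  · have hνr : r < |ν - c| := not_le.mp fun h => hν (hw0 ν h)
    have : 0 < ‖w ν‖ := norm_pos_iff.mpr hν
    simp only [norm_smul, mul_pow, Real.norm_eq_abs]
    gcongr

/-- The perturbation bound for an interval whose `ε`-neighborhood avoids zero. -/
theorem sum_finrank_eigenspace_le_tsum_closedBall {V W : H →L[ℝ] H} (hVc : IsCompactOperator V)
    (hWc : IsCompactOperator W) (hV : V.IsSymmetric) (hW : W.IsSymmetric) {ε : ℝ}
    (hVW : ‖V - W‖ ≤ ε) {c r : ℝ} (hr : 0 ≤ r) (h0 : r + ε < |c|) {T : Finset ℝ}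
    (hT : ∀ t ∈ T, |t - c| ≤ r) :
    (∑ t ∈ T, (Module.finrank ℝ (Module.End.eigenspace (V : H →ₗ[ℝ] H) t) : ℝ≥0∞)) ≤
      ∑' α : {x : ℝ | |x - c| ≤ r + ε},
        (Module.finrank ℝ (Module.End.eigenspace (W : H →ₗ[ℝ] H) (α : ℝ)) : ℝ≥0∞) := by
  classical
  have hε : 0 ≤ ε := (norm_nonneg _).trans hVW
  have hne (t : ℝ) (ht : |t - c| ≤ r + ε) : t ≠ 0 := by
    rintro rfl
    rw [zero_sub, abs_neg] at ht
    exact ht.not_gt h0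
  have hVfin (t : T) : FiniteDimensional ℝ (Module.End.eigenspace (V : H →ₗ[ℝ] H) (t : ℝ)) :=
    ContinuousLinearMap.finite_dimensional_eigenspace hVc _
      (hne t ((hT t t.2).trans (by linarith)))
  have hWfin (α : {x : ℝ | |x - c| ≤ r + ε}) :
      FiniteDimensional ℝ (Module.End.eigenspace (W : H →ₗ[ℝ] H) (α : ℝ)) :=
    ContinuousLinearMap.finite_dimensional_eigenspace hWc _ (hne α α.2)
  by_contra! hlt
  have hfinite := ENNReal.finite_const_le_of_tsum_ne_top hlt.ne_top one_ne_zero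
  set F := hfinite.toFinset with hF
  have hlt' : ∑ α ∈ F, Module.finrank ℝ (Module.End.eigenspace (W : H →ₗ[ℝ] H) (α : ℝ)) <
      ∑ t ∈ T, Module.finrank ℝ (Module.End.eigenspace (V : H →ₗ[ℝ] H) t) := by
    exact_mod_cast (ENNReal.sum_le_tsum F).trans_lt hlt
  let incl : (∀ t : T, Module.End.eigenspace (V : H →ₗ[ℝ] H) (t : ℝ)) →ₗ[ℝ] H :=
    ∑ t : T, (Submodule.subtype _) ∘ₗ LinearMap.proj t
  let Φ : (∀ t : T, Module.End.eigenspace (V : H →ₗ[ℝ] H) (t : ℝ)) →ₗ[ℝ]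
      ∀ α : F, Module.End.eigenspace (W : H →ₗ[ℝ] H) (α : ℝ) :=
    LinearMap.pi fun α =>
      ((Module.End.eigenspace (W : H →ₗ[ℝ] H) (α : ℝ)).orthogonalProjectionOnto :
        H →ₗ[ℝ] _) ∘ₗ incl
  have hker : LinearMap.ker Φ ≠ ⊥ := by
    apply LinearMap.ker_ne_bot_of_finrank_lt
    rw [Module.finrank_pi_fintype, Module.finrank_pi_fintype]
    rw [← Finset.sum_coe_sort F, ← Finset.sum_coe_sort T] at hlt'
    exact hlt'
  obtain ⟨v, hv, hv0⟩ := Submodule.exists_mem_ne_zero_of_ne_bot hker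
  have hsum : HasSum (fun t : T => (v t : H)) (incl v) := by
    simpa [incl] using hasSum_fintype (fun t : T => (v t : H))
  have hx0 : incl v ≠ 0 := by
    intro h
    have hnorm := (hV.orthogonalFamily_eigenspaces.comp
      (Subtype.val_injective (p := (· ∈ T)))).hasSum_norm_sq (w := v) hsum
    rw [h, norm_zero, zero_pow two_ne_zero, hasSum_zero_iff_of_nonneg fun _ => sq_nonneg _] at hnorm
    refine hv0 (funext fun t => ?_)
    simpa using congrFun hnorm t
  have hle := norm_apply_sub_smul_le_of_hasSum hV Subtype.val_injective hr
    (fun t : T => hT t t.2) hsum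
  have hgt := lt_norm_apply_sub_smul_of_mem_orthogonal hWc hW (add_nonneg hr hε) hx0
    (fun μ hμ => by
      by_cases hμF : (⟨μ, hμ⟩ : {x : ℝ | |x - c| ≤ r + ε}) ∈ F
      · exact Submodule.orthogonalProjectionOnto_eq_zero_iff.mp
          (congrFun (LinearMap.mem_ker.mp hv) ⟨_, hμF⟩)
      · have hbot : Module.End.eigenspace (W : H →ₗ[ℝ] H) μ = ⊥ := by
          rw [hF, Set.Finite.mem_toFinset, Set.mem_ofPred_eq] at hμF
          have := hWfin ⟨μ, hμ⟩
          exact Submodule.finrank_eq_zero.mp (by simpa [Nat.one_le_iff_ne_zero] using hμF)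
        simp [hbot])
  have hdiff : ‖(V - W) (incl v)‖ ≤ ε * ‖incl v‖ := (V - W).le_of_opNorm_le hVW _
  have htri : ‖W (incl v) - c • incl v‖ ≤ ‖V (incl v) - c • incl v‖ + ‖(V - W) (incl v)‖ := by
    have heq : W (incl v) - c • incl v = (V (incl v) - c • incl v) - (V - W) (incl v) := by
      rw [sub_apply]
      abel
    exact heq ▸ norm_sub_le _ _
  linarith

theorem sum_finrank_eigenspace_le_tsum_neighborhood {V W : H →L[ℝ] H} (hVc : IsCompactOperator V)
    (hWc : IsCompactOperator W) (hV : V.IsSymmetric) (hW : W.IsSymmetric) {ε : ℝ}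
    (hVW : ‖V - W‖ ≤ ε) (T : Finset ℝ) (hT : ∀ t ∈ T, ε < |t|) :
    (∑ t ∈ T, (Module.finrank ℝ (Module.End.eigenspace (V : H →ₗ[ℝ] H) t) : ℝ≥0∞)) ≤
      ∑' α : {x : ℝ | ∃ s ∈ T, |x - s| ≤ ε},
        (Module.finrank ℝ (Module.End.eigenspace (W : H →ₗ[ℝ] H) (α : ℝ)) : ℝ≥0∞) := by
  have hε : 0 ≤ ε := (norm_nonneg _).trans hVW
  induction T using Finset.strongInduction with
  | H T ih =>
  rcases T.eq_empty_or_nonempty with rfl | hne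
  · simp
  set a := T.min' hne with ha
  set b := T.max' hne with hb
  have haT : a ∈ T := T.min'_mem hne
  have hbT : b ∈ T := T.max'_mem hne
  have hab : a ≤ b := T.min'_le b hbT
  by_cases hcover : ∀ x, a - ε ≤ x → x ≤ b + ε → ∃ s ∈ T, |x - s| ≤ ε
  · refine (sum_finrank_eigenspace_le_tsum_closedBall hVc hWc hV hW hVW (c := (a + b) / 2)
      (r := (b - a) / 2) (by linarith) ?_ fun t ht => ?_).trans
      (ENNReal.tsum_mono_subtype
        (fun α => (Module.finrank ℝ (Module.End.eigenspace (W : H →ₗ[ℝ] H) α) : ℝ≥0∞))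
        fun x hx => ?_)
    · by_contra! h
      rw [abs_le] at h
      obtain ⟨s, hs, hs'⟩ := hcover 0 (by linarith) (by linarith)
      rw [zero_sub, abs_neg] at hs'
      exact (hT s hs).not_ge hs'
    · have := T.min'_le t ht
      have := T.le_max' t ht
      rw [abs_le]
      constructor <;> linarith
    · rw [Set.mem_ofPred_eq, abs_le] at hx
      exact hcover x (by linarith) (by linarith)
  · push Not at hcover
    obtain ⟨x, hax, hxb, hx⟩ := hcover
    have hxT : x ∉ T := fun h => (hx x h).not_ge (by simpa using hε)
    have hxa : a < x := by
      rcases lt_abs.mp (hx a haT) with h | h <;> linarith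
    have hbx : x < b := by
      rcases lt_abs.mp (hx b hbT) with h | h <;> linarith
    have hlow := ih (T.filter (· < x)) (Finset.filter_ssubset.mpr ⟨b, hbT, hbx.not_gt⟩)
      fun t ht => hT t (Finset.mem_filter.mp ht).1
    have hhigh := ih (T.filter (¬ · < x)) (Finset.filter_ssubset.mpr ⟨a, haT, not_not.mpr hxa⟩)
      fun t ht => hT t (Finset.mem_filter.mp ht).1
    rw [← Finset.sum_filter_add_sum_filter_not T (· < x)]
    refine (add_le_add hlow hhigh).trans ?_
    have hdisj : Disjoint {y : ℝ | ∃ s ∈ T.filter (· < x), |y - s| ≤ ε}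
        {y : ℝ | ∃ s ∈ T.filter (¬ · < x), |y - s| ≤ ε} := by
      rw [Set.disjoint_left]
      rintro y ⟨s, hs, hys⟩ ⟨t, ht, hyt⟩
      obtain ⟨hsT, hsx⟩ := Finset.mem_filter.mp hs
      obtain ⟨htT, htx⟩ := Finset.mem_filter.mp ht
      rw [abs_le] at hys hyt
      have h₁ := hx s hsT
      have h₂ := hx t htT
      rw [abs_of_pos (by linarith)] at h₁
      rw [abs_of_nonpos (by linarith)] at h₂
      linarith
    rw [← ENNReal.summable.tsum_union_disjoint
      (f := fun α => (Module.finrank ℝ (Module.End.eigenspace (W : H →ₗ[ℝ] H) α) : ℝ≥0∞))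
      hdisj ENNReal.summable]
    refine ENNReal.tsum_mono_subtype
      (fun α => (Module.finrank ℝ (Module.End.eigenspace (W : H →ₗ[ℝ] H) α) : ℝ≥0∞)) ?_
    rintro y (⟨s, hs, hys⟩ | ⟨s, hs, hys⟩) <;> exact ⟨s, (Finset.mem_filter.mp hs).1, hys⟩

end Eigenspaces

/-- **Eigenvalue perturbation for compact self-adjoint operators.**
If `V, W` are compact self-adjoint operators on a real Hilbert space with
`‖V − W‖ ≤ ε`, and `S ⊆ ℝ` satisfies `inf_{s ∈ S} |s| > ε`, then the total
multiplicity of the eigenvalues of `V` lying in `S` is at most the total multiplicity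
of the eigenvalues of `W` lying in the `ε`-neighborhood `S^ε` of `S`. -/
theorem compact_selfAdjoint_eigenvalue_multiplicity_perturbation
    {H : Type*} [NormedAddCommGroup H] [InnerProductSpace ℝ H] [CompleteSpace H]
    (V W : H →L[ℝ] H)
    (hVcomp : IsCompactOperator V) (hWcomp : IsCompactOperator W)
    (hVsa : IsSelfAdjoint V) (hWsa : IsSelfAdjoint W)
    (ε : ℝ) (hVW : ‖V - W‖ ≤ ε)
    (S : Set ℝ) (hS : ε < sInf ((fun s => |s|) '' S)) :
    (∑' α : S,
        (Module.finrank ℝ (Module.End.eigenspace (V : H →ₗ[ℝ] H) (α : ℝ)) : ℝ≥0∞))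
      ≤ ∑' α : {x : ℝ | ∃ s ∈ S, |x - s| ≤ ε},
          (Module.finrank ℝ (Module.End.eigenspace (W : H →ₗ[ℝ] H) (α : ℝ)) : ℝ≥0∞) := by
  have hSε (s : ℝ) (hs : s ∈ S) : ε < |s| :=
    hS.trans_le (csInf_le ⟨0, by rintro _ ⟨t, -, rfl⟩; exact abs_nonneg t⟩ ⟨s, hs, rfl⟩)
  rw [ENNReal.tsum_eq_iSup_sum]
  refine iSup_le fun T => ?_
  have h := sum_finrank_eigenspace_le_tsum_neighborhood hVcomp hWcomp hVsa.isSymmetric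
    hWsa.isSymmetric hVW (T.map (Function.Embedding.subtype _)) (by
      intro t ht
      obtain ⟨s, -, rfl⟩ := Finset.mem_map.mp ht
      exact hSε s s.2)
  rw [Finset.sum_map] at h
  refine h.trans (ENNReal.tsum_mono_subtype
    (fun α => (Module.finrank ℝ (Module.End.eigenspace (W : H →ₗ[ℝ] H) α) : ℝ≥0∞)) ?_)
  rintro x ⟨t, ht, hxt⟩
  obtain ⟨s, -, rfl⟩ := Finset.mem_map.mp ht
  exact ⟨s, s.2, hxt⟩
end
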